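/- Let P, P⁰ be orthogonal projections with Q = P − P⁰ Hilbert–Schmidt. Then Tr_{P⁰}(Q) := Tr((1−P⁰)Q(1−P⁰)) + Tr(P⁰QP⁰) equals Tr(Q³), and this quantity is an integer. -/

import Mathlib

open scoped InnerProductSpace

set_option linter.unusedSectionVars false

section helpers
variable {H : Type*} [NormedAddCommGroup H] [InnerProductSpace ℂ H] [CompleteSpace H] {ι : Type*}

theorem hs_parseval {E : Type*} [NormedAddCommGroup E] [InnerProductSpace ℂ E]
    (b : HilbertBasis ι ℂ E) (x : E) :
    HasSum (fun j => ‖⟪b j, x⟫_ℂ‖ ^ 2) (‖x‖ ^ 2) := by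
  have h := b.hasSum_inner_mul_inner x x
  have h2 : HasSum (fun j => ((‖⟪b j, x⟫_ℂ‖ ^ 2 : ℝ) : ℂ)) ((‖x‖ ^ 2 : ℝ) : ℂ) := by
    convert h using 1
    · rfl
    · funext j
      rw [← inner_conj_symm x (b j), RCLike.conj_mul]
      simp
    · rw [inner_self_eq_norm_sq_to_K]
      simp
  exact Complex.hasSum_ofReal.mp h2

theorem hs_fub {α β : Type*} (f : α → β → ℝ) (hf : ∀ a b, 0 ≤ f a b) (s : α → ℝ)
    (h : ∀ a, HasSum (f a) (s a)) (hs : Summable s) :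
    Summable fun p : α × β => f p.1 p.2 := by
  rw [summable_prod_of_nonneg (fun p => hf _ _)]
  refine ⟨fun i => (h i).summable, ?_⟩
  have : (fun x => ∑' y, f x y) = s := funext fun x => (h x).tsum_eq
  simpa [this] using hs

theorem hs_prod (b : HilbertBasis ι ℂ H) (X : H →L[ℂ] H) (hX : Summable fun i => ‖X (b i)‖ ^ 2) :
    Summable fun p : ι × ι => ‖⟪b p.1, X (b p.2)⟫_ℂ‖ ^ 2 := by
  have h : Summable fun p : ι × ι => ‖⟪b p.2, X (b p.1)⟫_ℂ‖ ^ 2 := by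
    exact hs_fub (fun i j => ‖⟪b j, X (b i)⟫_ℂ‖ ^ 2) (fun _ _ => sq_nonneg _) _
      (fun i => hs_parseval b (X (b i))) hX
  exact (Equiv.prodComm ι ι).summable_iff.mp h

theorem hs_cyclic (b : HilbertBasis ι ℂ H) (X Y : H →L[ℂ] H)
    (hX : Summable fun i => ‖X (b i)‖ ^ 2) (hY : Summable fun i => ‖Y (b i)‖ ^ 2) :
    ∃ S : ℂ, HasSum (fun i => ⟪b i, (X * Y) (b i)⟫_ℂ) S ∧
      HasSum (fun i => ⟪b i, (Y * X) (b i)⟫_ℂ) S := by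
  have h1 := hs_prod b X hX
  have h2 := (Equiv.prodComm ι ι).summable_iff.mpr (hs_prod b Y hY)
  have hF : Summable fun p : ι × ι => ⟪b p.1, X (b p.2)⟫_ℂ * ⟪b p.2, Y (b p.1)⟫_ℂ := by
    refine Summable.of_norm_bounded (h1.add h2) fun p => ?_
    rw [norm_mul]
    simp only [Function.comp, Equiv.prodComm_apply, Prod.fst_swap, Prod.snd_swap]
    nlinarith [sq_nonneg (‖⟪b p.1, X (b p.2)⟫_ℂ‖ - ‖⟪b p.2, Y (b p.1)⟫_ℂ‖),
      sq_nonneg ‖⟪b p.1, X (b p.2)⟫_ℂ‖, sq_nonneg ‖⟪b p.2, Y (b p.1)⟫_ℂ‖]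
  have key : ∀ (X Y : H →L[ℂ] H) (i : ι),
      HasSum (fun j => ⟪b i, X (b j)⟫_ℂ * ⟪b j, Y (b i)⟫_ℂ) ⟪b i, (X * Y) (b i)⟫_ℂ := by
    intro X Y i
    have := b.hasSum_inner_mul_inner (ContinuousLinearMap.adjoint X (b i)) (Y (b i))
    simp only [ContinuousLinearMap.adjoint_inner_left] at this
    exact this
  obtain ⟨S, hS⟩ := hF
  refine ⟨S, hS.prod_fiberwise (fun i => key X Y i), ?_⟩
  have hS' := (Equiv.prodComm ι ι).hasSum_iff.mpr hS
  refine hS'.prod_fiberwise (fun i => ?_)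
  simpa [Function.comp, mul_comm] using key Y X i

theorem hs_count {κ : Type*} (b : HilbertBasis ι ℂ H) (F : H →L[ℂ] H) (e : κ → H)
    (he : ∀ j, ‖e j‖ = 1) (hpars : ∀ x, HasSum (fun j => ‖⟪e j, x⟫_ℂ‖ ^ 2) (‖F x‖ ^ 2))
    (hs : Summable fun i => ‖F (b i)‖ ^ 2) :
    ∃ n : ℕ, HasSum (fun i => ‖F (b i)‖ ^ 2) (n : ℝ) := by
  have hprod : Summable fun p : ι × κ => ‖⟪e p.2, b p.1⟫_ℂ‖ ^ 2 :=
    hs_fub (fun i j => ‖⟪e j, b i⟫_ℂ‖ ^ 2) (fun _ _ => sq_nonneg _) _ (fun i => hpars (b i)) hs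
  obtain ⟨S, hS⟩ := hprod
  have h1 : HasSum (fun i => ‖F (b i)‖ ^ 2) S :=
    HasSum.prod_fiberwise hS (fun i => hpars (b i))
  have hS' : HasSum (fun p : κ × ι => ‖⟪e p.1, b p.2⟫_ℂ‖ ^ 2) S :=
    (Equiv.prodComm κ ι).hasSum_iff.mpr hS
  have h4 : ∀ j : κ, HasSum (fun i => ‖⟪e j, b i⟫_ℂ‖ ^ 2) 1 := fun j => by
    have h := hs_parseval b (e j)
    rw [he j, one_pow] at h
    have h5 : (fun i => ‖⟪e j, b i⟫_ℂ‖ ^ 2) = fun i => ‖⟪b i, e j⟫_ℂ‖ ^ 2 :=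
      funext fun i => by rw [norm_inner_symm]
    rw [h5]
    exact h
  have h2 : HasSum (fun _ : κ => (1 : ℝ)) S := HasSum.prod_fiberwise hS' h4
  have hfin : Finite κ := by
    by_contra hcon
    rw [not_finite_iff_infinite] at hcon
    have := h2.summable
    rw [summable_const_iff] at this
    exact one_ne_zero this
  have := Fintype.ofFinite κ
  have hSn : S = (Fintype.card κ : ℝ) :=
    h2.unique (by simpa using hasSum_fintype (fun _ : κ => (1 : ℝ)))
  rw [hSn] at h1
  exact ⟨Fintype.card κ, h1⟩

theorem hs_proj (b : HilbertBasis ι ℂ H) (F : H →L[ℂ] H) (hF : IsSelfAdjoint F)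
    (hFF : F * F = F) (hs : Summable fun i => ‖F (b i)‖ ^ 2) :
    ∃ n : ℕ, HasSum (fun i => ⟪b i, F (b i)⟫_ℂ) n := by
  have hadj : ∀ x y, ⟪F x, y⟫_ℂ = ⟪x, F y⟫_ℂ := fun x y => by
    conv_lhs => rw [← ContinuousLinearMap.adjoint_inner_right, hF.adjoint_eq]
  have hFx : ∀ x, F (F x) = F x := fun x => congrArg (fun A : H →L[ℂ] H => A x) hFF
  obtain ⟨K, hK⟩ : ∃ K : Submodule ℂ H, ∀ x, x ∈ K ↔ F x = x :=
    ⟨LinearMap.ker ((1 - F : H →L[ℂ] H) : H →ₗ[ℂ] H), fun x => by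
      rw [eq_comm, ← sub_eq_zero]
      rfl⟩
  have hc : IsClosed (K : Set H) := by
    have : (K : Set H) = {x | F x = x} := Set.ext hK
    rw [this]
    exact isClosed_eq F.continuous continuous_id
  have : CompleteSpace K := hc.completeSpace_coe
  obtain ⟨w, e, -⟩ := exists_hilbertBasis ℂ K
  have hin : ∀ x j, ⟪(e j : H), x⟫_ℂ = ⟪(e j : H), F x⟫_ℂ := fun x j => by
    rw [← hadj, (hK _).1 (e j).2]
  obtain ⟨n, hn⟩ := hs_count b F (fun j => (e j : H)) (fun j => e.orthonormal.1 j)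
    (fun x => by
      have h := hs_parseval e ⟨F x, (hK _).2 (hFx x)⟩
      simp only [hin x]
      exact h) hs
  refine ⟨n, ?_⟩
  have h3 := Complex.hasSum_ofReal.mpr hn
  rw [Complex.ofReal_natCast] at h3
  have h4 : (fun i => ⟪b i, F (b i)⟫_ℂ) = fun i => ((‖F (b i)‖ ^ 2 : ℝ) : ℂ) := by
    funext i
    rw [← hFx, ← hadj, inner_self_eq_norm_sq_to_K, hFx]
    simp
  rw [h4]
  exact h3

/-- `A` has trace `S` in the basis `b`. -/
def HTr (b : HilbertBasis ι ℂ H) (A : H →L[ℂ] H) (S : ℂ) : Prop :=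
  HasSum (fun i => ⟪b i, A (b i)⟫_ℂ) S

theorem HTr.add {b : HilbertBasis ι ℂ H} {A A' : H →L[ℂ] H} {S S' : ℂ} (h : HTr b A S)
    (h' : HTr b A' S') : HTr b (A + A') (S + S') := by
  have := HasSum.add h h'
  simpa only [HTr, add_apply, inner_add_right] using this

theorem HTr.sub {b : HilbertBasis ι ℂ H} {A A' : H →L[ℂ] H} {S S' : ℂ} (h : HTr b A S)
    (h' : HTr b A' S') : HTr b (A - A') (S - S') := by
  have := HasSum.sub h h'
  simpa only [HTr, sub_apply, inner_sub_right] using this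

theorem HTr.neg {b : HilbertBasis ι ℂ H} {A : H →L[ℂ] H} {S : ℂ} (h : HTr b A S) :
    HTr b (-A) (-S) := by
  have := HasSum.neg h
  simpa only [HTr, neg_apply, inner_neg_right] using this

theorem HTr.zero (b : HilbertBasis ι ℂ H) : HTr b (0 : H →L[ℂ] H) 0 := by
  simp [HTr, hasSum_zero]

theorem HTr.smul {b : HilbertBasis ι ℂ H} {A : H →L[ℂ] H} {S : ℂ} (c : ℂ) (h : HTr b A S) :
    HTr b (c • A) (c * S) := by
  have := HasSum.mul_left c h
  simpa only [HTr, smul_apply, inner_smul_right] using this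

theorem hs_left (b : HilbertBasis ι ℂ H) (A X : H →L[ℂ] H)
    (hX : Summable fun i => ‖X (b i)‖ ^ 2) : Summable fun i => ‖(A * X) (b i)‖ ^ 2 := by
  refine Summable.of_nonneg_of_le (fun i => sq_nonneg _) (fun i => ?_) (hX.mul_left (‖A‖ ^ 2))
  rw [← mul_pow]
  exact pow_le_pow_left₀ (norm_nonneg _) (A.le_opNorm _) 2

/-- Cyclicity gives a vanishing trace when the factors anticommute. -/
theorem hs_zero (b : HilbertBasis ι ℂ H) (X Y Z : H →L[ℂ] H)
    (hX : Summable fun i => ‖X (b i)‖ ^ 2) (hY : Summable fun i => ‖Y (b i)‖ ^ 2)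
    (h1 : X * Y = -Z) (h2 : Y * X = Z) : HTr b Z 0 := by
  obtain ⟨S, hS1, hS2⟩ := hs_cyclic b X Y hX hY
  have hS1 : HTr b (X * Y) S := hS1
  have hS2 : HTr b (Y * X) S := hS2
  rw [h1] at hS1
  rw [h2] at hS2
  have h3 : HTr b Z (-S) := by simpa using hS1.neg
  have h4 : S = -S := HasSum.unique hS2 h3
  have h5 : S = 0 := by linear_combination (1 / 2 : ℂ) * h4
  rwa [h5] at hS2

/-- The case of `Q` self-adjoint, of square-summable entries. -/
theorem core_pow (b : HilbertBasis ι ℂ H) (Q B : H →L[ℂ] H)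
    (anti : Q * B = -(B * Q)) (hsq : Q * Q + B * B = 1)
    (hHS : Summable fun i => ‖Q (b i)‖ ^ 2) (c : ℂ) (hc : HTr b (Q * Q * Q) c) (k : ℕ) :
    HTr b (Q * (Q * Q) ^ k * Q * Q) c := by
  induction k with
  | zero => simpa using hc
  | succ k ih =>
    have hcomm : Commute B (Q * Q) := by
      change B * (Q * Q) = Q * Q * B
      have : B * Q = -(Q * B) := by rw [anti, neg_neg]
      rw [← mul_assoc, this, neg_mul, mul_assoc, this, mul_neg, neg_neg, mul_assoc]
    have hk : B * (Q * Q) ^ (k + 1) = (Q * Q) ^ (k + 1) * B := hcomm.pow_right (k + 1)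
    have hq : Q * (Q * Q) ^ (k + 1) = (Q * Q) ^ (k + 1) * Q :=
      ((Commute.refl Q).mul_right (Commute.refl Q)).pow_right (k + 1)
    have hq' : Q * (Q * Q) ^ k = (Q * Q) ^ k * Q :=
      ((Commute.refl Q).mul_right (Commute.refl Q)).pow_right k
    have hz : HTr b ((Q * Q) ^ (k + 1) * Q * B * B) 0 := by
      refine hs_zero b ((Q * Q) ^ (k + 1) * B) (Q * B) _ ?_ ?_ ?_ ?_
      · rw [← hk, pow_succ, ← mul_assoc, ← mul_assoc]
        exact hs_left b _ Q hHS
      · rw [anti]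
        have := hs_left b (-B) Q hHS
        simpa using this
      · rw [anti, mul_neg, mul_assoc _ B, ← mul_assoc B B, ← mul_assoc _ Q B |>.symm]
        have h1 : B * B * Q = Q * B * B := by
          rw [mul_assoc, ← neg_neg (B * Q), ← anti, mul_neg, ← mul_assoc, ← neg_mul, ← anti]
        rw [h1]
        simp only [mul_assoc]
      · rw [mul_assoc Q B, ← mul_assoc B, hk, ← hq]
        simp only [mul_assoc]
    have hBB : B * B = 1 - Q * Q := by rw [← hsq]; abel
    have := ih.sub hz
    rw [sub_zero] at this
    convert this using 1
    rw [mul_assoc _ B B, hBB, hq, hq', mul_sub, mul_one, pow_succ]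
    simp only [mul_assoc]
    abel

theorem avg_norm (T : H →L[ℂ] H) (hT : ‖T‖ ≤ 1) (n : ℕ) :
    ‖(n : ℂ)⁻¹ • ∑ k ∈ Finset.range n, T ^ k‖ ≤ 1 := by
  have h1 : ∀ k : ℕ, ‖T ^ k‖ ≤ 1 := fun k => by
    induction k with
    | zero => rw [pow_zero]; exact ContinuousLinearMap.norm_id_le
    | succ k ih =>
      rw [pow_succ]
      exact (norm_mul_le _ _).trans (mul_le_one₀ ih (norm_nonneg _) hT)
  have h2 : ‖∑ k ∈ Finset.range n, T ^ k‖ ≤ n := by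
    refine (norm_sum_le _ _).trans ((Finset.sum_le_sum fun k _ => h1 k).trans ?_)
    simp
  rw [norm_smul, norm_inv, RCLike.norm_natCast]
  calc (n : ℝ)⁻¹ * _ ≤ (n : ℝ)⁻¹ * n := by gcongr
    _ ≤ 1 := inv_mul_le_one

set_option maxHeartbeats 1000000 in
theorem core (b : HilbertBasis ι ℂ H) (Q B : H →L[ℂ] H) (hQ : IsSelfAdjoint Q)
    (hB : IsSelfAdjoint B) (anti : Q * B = -(B * Q)) (hsq : Q * Q + B * B = 1)
    (hHS : Summable fun i => ‖Q (b i)‖ ^ 2) :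
    ∃ n : ℤ, HTr b (Q * Q * Q) n := by
  have hadj : ∀ A : H →L[ℂ] H, IsSelfAdjoint A → ∀ x y, ⟪A x, y⟫_ℂ = ⟪x, A y⟫_ℂ :=
    fun A hA x y => by
    conv_lhs => rw [← ContinuousLinearMap.adjoint_inner_right, hA.adjoint_eq]
  have hQn : ∀ x, ‖Q x‖ ≤ ‖x‖ := fun x => by
    have h1 : ⟪Q x, Q x⟫_ℂ + ⟪B x, B x⟫_ℂ = ⟪x, x⟫_ℂ := by
      rw [hadj Q hQ, hadj B hB, ← inner_add_right]
      exact congrArg (fun A : H →L[ℂ] H => ⟪x, A x⟫_ℂ) hsq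
    simp only [inner_self_eq_norm_sq_to_K] at h1
    have h2 : ‖Q x‖ ^ 2 + ‖B x‖ ^ 2 = ‖x‖ ^ 2 := by exact_mod_cast h1
    exact le_of_sq_le_sq (by nlinarith [sq_nonneg ‖B x‖]) (norm_nonneg _)
  have hQ1 : ‖Q‖ ≤ 1 := Q.opNorm_le_bound zero_le_one (by simpa using hQn)
  set T : H →L[ℂ] H := Q * Q with hTdef
  have hT1 : ‖T‖ ≤ 1 := (norm_mul_le _ _).trans (mul_le_one₀ hQ1 (norm_nonneg _) hQ1)
  obtain ⟨c, hc, -⟩ := hs_cyclic b (Q * Q) Q (hs_left b Q Q hHS) hHS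
  change HTr b (Q * Q * Q) c at hc
  have hpow := core_pow b Q B anti hsq hHS c hc
  let A : ℕ → (H →L[ℂ] H) := fun n => (n : ℂ)⁻¹ • ∑ k ∈ Finset.range n, T ^ k
  have hA : ∀ n : ℕ, n ≠ 0 → HTr b (Q * A n * Q * Q) c := fun n hn => by
    have h1 : ∀ n : ℕ, HTr b (Q * (∑ k ∈ Finset.range n, T ^ k) * Q * Q) (n * c) := fun n => by
      induction n with
      | zero => simpa using HTr.zero b
      | succ n ih =>
        have := ih.add (hpow n)
        rw [Finset.sum_range_succ]
        convert this using 1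
        · simp only [mul_add, add_mul]
          rfl
        · push_cast; ring
    have h2 := (h1 n).smul (n : ℂ)⁻¹
    have hn' : (n : ℂ) ≠ 0 := Nat.cast_ne_zero.mpr hn
    rw [inv_mul_cancel_left₀ hn'] at h2
    simpa only [A, mul_smul_comm, smul_mul_assoc] using h2
  -- the limit projection
  let K := T.eqLocus (1 : H →L[ℂ] H)
  have hKmem : ∀ x, x ∈ K ↔ T x = x := fun x => Iff.rfl
  have hKc : IsClosed (K : Set H) := by
    have : (K : Set H) = {x | T x = x} := rfl
    rw [this]
    exact isClosed_eq T.continuous continuous_id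
  have : CompleteSpace K := hKc.completeSpace_coe
  let E : H →L[ℂ] H := K.starProjection
  have hEsa : IsSelfAdjoint E := isSelfAdjoint_starProjection K
  have hEmem : ∀ x, T (E x) = E x := fun x => (hKmem _).1 (K.starProjection_apply_mem x)
  have hEfix : ∀ x, T x = x → E x = x := fun x hx =>
    K.starProjection_eq_self_iff.2 ((hKmem _).2 hx)
  have hTE : Q * Q * E = E := ContinuousLinearMap.ext hEmem
  have hEE : E * E = E := ContinuousLinearMap.ext fun x => hEfix _ (hEmem x)
  have hEQE : E * (Q * E) = Q * E := ContinuousLinearMap.ext fun x =>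
    hEfix (Q (E x)) (congrArg Q (hEmem x))
  have hcomm : E * Q = Q * E := by
    have := congrArg star hEQE
    simp only [star_mul, hEsa.star_eq, hQ.star_eq] at this
    rw [← this, mul_assoc, hEQE]
  have hlim : ∀ x, Filter.Tendsto (fun n => A n x) Filter.atTop (nhds (E x)) := fun x => by
    have := T.tendsto_birkhoffAverage_orthogonalProjection hT1 x
    convert this using 2 with n
    · simp [A, birkhoffAverage, birkhoffSum]
    · rfl
  -- dominated convergence
  have htr : (∑' i, ⟪b i, (Q * E * Q * Q) (b i)⟫_ℂ) = c := by
    have h1 : Filter.Tendsto (fun n => ∑' i, ⟪b i, (Q * A n * Q * Q) (b i)⟫_ℂ) Filter.atTop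
        (nhds (∑' i, ⟪b i, (Q * E * Q * Q) (b i)⟫_ℂ)) := by
      refine tendsto_tsum_of_dominated_convergence hHS (fun i => ?_)
        (Filter.Eventually.of_forall fun n i => ?_)
      · exact Filter.Tendsto.inner tendsto_const_nhds
          ((Q.continuous.tendsto _).comp (hlim (Q (Q (b i)))))
      · change ‖⟪b i, Q (A n (Q (Q (b i))))⟫_ℂ‖ ≤ _
        rw [← hadj Q hQ, sq]
        refine (norm_inner_le_norm _ _).trans ?_
        gcongr
        refine ((A n).le_of_opNorm_le (avg_norm T hT1 n) _).trans ?_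
        rw [one_mul]
        exact hQn _
    refine tendsto_nhds_unique h1 (tendsto_const_nhds.congr' ?_)
    filter_upwards [Filter.eventually_ne_atTop 0] with n hn
    exact (HasSum.tsum_eq (hA n hn)).symm
  have hQE : Q * E * Q * Q = Q * E := by
    rw [mul_assoc (Q * E), mul_assoc Q E, ← mul_assoc E, hcomm, mul_assoc Q E, hcomm,
      ← mul_assoc Q Q E, hTE]
  rw [hQE] at htr
  have hEhs : Summable fun i => ‖E (b i)‖ ^ 2 := by
    have h : E = E * Q * Q := by rw [hcomm, mul_assoc, hcomm, ← mul_assoc, hTE]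
    rw [h]
    exact hs_left b _ Q hHS
  have hsa : star (Q * E) = Q * E := by rw [star_mul, hEsa.star_eq, hQ.star_eq, hcomm]
  have hQEQE : Q * E * (Q * E) = E := by
    rw [mul_assoc, hEQE, ← mul_assoc, hTE]
  have hEQ2 : Q * E * E = Q * E := by rw [mul_assoc, hEE]
  have hproj : ∀ s : ℝ, s * s = 1 →
      ∃ n : ℕ, HTr b ((1 / 2 : ℝ) • (E + s • (Q * E))) n := fun s hs => by
    refine hs_proj b _ ?_ ?_ ?_
    · rw [IsSelfAdjoint, star_smul, star_add, star_smul, hsa, hEsa.star_eq]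
      simp
    · simp only [smul_mul_assoc, mul_smul_comm, mul_add, add_mul, hEE, hEQE, hQEQE, hEQ2,
        smul_smul, smul_add]
      rcases mul_self_eq_one_iff.mp hs with rfl | rfl <;> module
    · have : (1 / 2 : ℝ) • (E + s • (Q * E)) = ((1 / 2 : ℝ) • (1 + s • Q)) * E := by
        simp [add_mul]
      rw [this]
      exact hs_left b _ E hEhs
  obtain ⟨n, hn⟩ := hproj 1 (by norm_num)
  obtain ⟨m, hm⟩ := hproj (-1) (by norm_num)
  refine ⟨n - m, ?_⟩
  have hd := hn.sub hm
  have he : (1 / 2 : ℝ) • (E + (1 : ℝ) • (Q * E)) - (1 / 2 : ℝ) • (E + (-1 : ℝ) • (Q * E))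
      = Q * E := by module
  rw [he] at hd
  have hce : c = n - m := by rw [← htr]; exact HasSum.tsum_eq hd
  rw [hce] at hc
  push_cast
  exact hc



end helpers

/-- For orthogonal projections `P, P⁰` with `Q = P − P⁰` Hilbert–Schmidt,
the `P⁰`-trace `Tr_{P⁰}(Q) = Tr((1−P⁰)Q(1−P⁰)) + Tr(P⁰QP⁰)` equals `Tr(Q³)`, and this
quantity is an integer. -/
theorem pzero_trace_is_integer {H : Type*} [NormedAddCommGroup H]
    [InnerProductSpace ℂ H] [CompleteSpace H] {ι : Type*} (b : HilbertBasis ι ℂ H)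
    (P P0 : H →L[ℂ] H)
    (hP : IsSelfAdjoint P) (hPproj : P * P = P)
    (hP0 : IsSelfAdjoint P0) (hP0proj : P0 * P0 = P0)
    (hHS : Summable fun i => ‖(P - P0) (b i)‖ ^ 2) :
    (Summable fun i => ⟪b i, ((1 - P0) * (P - P0) * (1 - P0)) (b i)⟫_ℂ) ∧
      (Summable fun i => ⟪b i, (P0 * (P - P0) * P0) (b i)⟫_ℂ) ∧
      (Summable fun i => ⟪b i, ((P - P0) * (P - P0) * (P - P0)) (b i)⟫_ℂ) ∧
      (∑' i, ⟪b i, ((1 - P0) * (P - P0) * (1 - P0)) (b i)⟫_ℂ) +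
          (∑' i, ⟪b i, (P0 * (P - P0) * P0) (b i)⟫_ℂ) =
        ∑' i, ⟪b i, ((P - P0) * (P - P0) * (P - P0)) (b i)⟫_ℂ ∧
      ∃ n : ℤ,
        (∑' i, ⟪b i, ((1 - P0) * (P - P0) * (1 - P0)) (b i)⟫_ℂ) +
            (∑' i, ⟪b i, (P0 * (P - P0) * P0) (b i)⟫_ℂ) = (n : ℂ) := by
  set Q := P - P0 with hQd
  have hQP0 : Q * (1 - P0) = P * Q := by
    simp only [hQd, sub_mul, mul_sub, mul_one, hPproj, hP0proj]; abel
  have hQP0b : Q * P0 = (1 - P) * Q := by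
    simp only [hQd, sub_mul, mul_sub, one_mul, hPproj, hP0proj]; abel
  have e1 : (1 - P0) * Q * (1 - P0) = Q * (Q * (1 - P0)) := by
    simp only [hQd, sub_mul, mul_sub, mul_one, one_mul, hPproj, hP0proj, mul_assoc]
    simp only [← mul_assoc, hPproj, hP0proj]; abel
  have e2 : P0 * Q * P0 = -(Q * (Q * P0)) := by
    simp only [hQd, sub_mul, mul_sub, mul_one, one_mul, hPproj, hP0proj, mul_assoc]
    simp only [← mul_assoc, hPproj, hP0proj]; abel
  have anti : Q * (1 - P - P0) = -((1 - P - P0) * Q) := by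
    simp only [hQd, sub_mul, mul_sub, mul_one, one_mul, hPproj, hP0proj]; abel
  have hsq : Q * Q + (1 - P - P0) * (1 - P - P0) = 1 := by
    simp only [hQd, sub_mul, mul_sub, mul_one, one_mul, hPproj, hP0proj]; abel
  obtain ⟨n, hn⟩ := core b Q (1 - P - P0) (hP.sub hP0)
    (((IsSelfAdjoint.one _).sub hP).sub hP0) anti hsq hHS
  obtain ⟨S1, h1, -⟩ := hs_cyclic b Q (Q * (1 - P0)) hHS (by rw [hQP0]; exact hs_left b _ Q hHS)
  obtain ⟨S2, h2, -⟩ := hs_cyclic b Q (Q * P0) hHS (by rw [hQP0b]; exact hs_left b _ Q hHS)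
  have h1 : HTr b ((1 - P0) * Q * (1 - P0)) S1 := by rw [e1]; exact h1
  have h2 : HTr b (P0 * Q * P0) (-S2) := by rw [e2]; exact HTr.neg h2
  have hz : HTr b (Q * Q * (1 - P - P0)) 0 := by
    refine hs_zero b (Q * (1 - P - P0)) Q _ ?_ hHS ?_ ?_
    · rw [anti, ← neg_mul]; exact hs_left b _ Q hHS
    · rw [mul_assoc, ← neg_eq_iff_eq_neg.mpr anti, mul_neg, mul_assoc]
    · rw [mul_assoc]
  have hsum : HTr b (Q * Q * Q) (S1 + -S2) := by
    have h := (h1.add h2).sub hz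
    rw [sub_zero] at h
    convert h using 1
    rw [e1, e2]
    simp only [hQd, sub_mul, mul_sub, mul_one, mul_assoc]
    abel
  have heq : S1 + -S2 = n := HasSum.unique hsum hn
  have t1 := HasSum.tsum_eq h1
  have t2 := HasSum.tsum_eq h2
  have t3 := HasSum.tsum_eq hsum
  refine ⟨HasSum.summable h1, HasSum.summable h2, HasSum.summable hsum, ?_, n, ?_⟩
  · rw [t1, t2, t3]
  · rw [t1, t2, heq]
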